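/- For the bound quiver (Q, αβ=0) above with n vertices, the number of isomorphism classes of representations M whose endomorphism ring is a division ring is finite; indeed every such M is a representation of either the D_n-type quiver obtained by deleting α or the A_n-type quiver obtained by deleting β. -/

import Mathlib

/-- A representation of the bound quiver (Q, αβ = 0): vertices 1,…,n (n ≥ 3),
arrows α : 2 → 1, β : 3 → 2, γ : 3 → 1, and arrows δᵢ : i → i-1 for 4 ≤ i ≤ n,
with the relation α ∘ β = 0. -/
structure QRep (k : Type) [Field k] (n : ℕ) where
  V : ℕ → Type
  [acg : ∀ i, AddCommGroup (V i)]
  [mod : ∀ i, Module k (V i)]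
  fd : ∀ i, FiniteDimensional k (V i)
  supp : ∀ i, (i = 0 ∨ n < i) → Subsingleton (V i)
  α : V 2 →ₗ[k] V 1
  β : V 3 →ₗ[k] V 2
  γ : V 3 →ₗ[k] V 1
  δ : ∀ i, 4 ≤ i → i ≤ n → (V i →ₗ[k] V (i-1))
  rel : α ∘ₗ β = 0

attribute [instance] QRep.acg QRep.mod

variable {k : Type} [Field k] {n : ℕ}

/-- An endomorphism of a representation of (Q, αβ = 0): linear maps at each
vertex commuting with all arrow maps. -/
structure QEnd (M : QRep k n) where
  f : ∀ i, M.V i →ₗ[k] M.V i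
  commα : f 1 ∘ₗ M.α = M.α ∘ₗ f 2
  commβ : f 2 ∘ₗ M.β = M.β ∘ₗ f 3
  commγ : f 1 ∘ₗ M.γ = M.γ ∘ₗ f 3
  commδ : ∀ i (h1 : 4 ≤ i) (h2 : i ≤ n),
    f (i-1) ∘ₗ M.δ i h1 h2 = M.δ i h1 h2 ∘ₗ f i

/-- A family of subspaces closed under all the arrow maps (a subrepresentation). -/
def IsSubrep (M : QRep k n) (p : ∀ i, Submodule k (M.V i)) : Prop :=
  (∀ x ∈ p 2, M.α x ∈ p 1) ∧ (∀ x ∈ p 3, M.β x ∈ p 2) ∧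
  (∀ x ∈ p 3, M.γ x ∈ p 1) ∧
  (∀ i (h1 : 4 ≤ i) (h2 : i ≤ n), ∀ x ∈ p i, M.δ i h1 h2 x ∈ p (i-1))

/-- A representation is indecomposable iff it is nonzero and admits no splitting
into two nonzero complementary subrepresentations. -/
def QIndec (M : QRep k n) : Prop :=
  (∃ i, ∃ x : M.V i, x ≠ 0) ∧
  ∀ p q, IsSubrep M p → IsSubrep M q → (∀ i, IsCompl (p i) (q i)) →
    (∀ i, p i = ⊥) ∨ (∀ i, q i = ⊥)

/-- An isomorphism of representations of (Q, αβ = 0). -/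
def QIso (M N : QRep k n) : Prop :=
  ∃ e : ∀ i, M.V i ≃ₗ[k] N.V i,
    (∀ x, e 1 (M.α x) = N.α (e 2 x)) ∧
    (∀ x, e 2 (M.β x) = N.β (e 3 x)) ∧
    (∀ x, e 1 (M.γ x) = N.γ (e 3 x)) ∧
    (∀ i (h1 : 4 ≤ i) (h2 : i ≤ n), ∀ x, e (i-1) (M.δ i h1 h2 x) = N.δ i h1 h2 (e i x))

/-- End(M) is a division ring: every nonzero endomorphism is invertible. -/
def QEndDivision (M : QRep k n) : Prop :=
  ∀ φ : QEnd M, (∃ i, φ.f i ≠ 0) →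
    ∃ ψ : QEnd M, ∀ i, ψ.f i ∘ₗ φ.f i = LinearMap.id ∧ φ.f i ∘ₗ ψ.f i = LinearMap.id

open Module

/-! ### Frames: simultaneous 0-1 normal forms -/

/-- The scalar `0` or `1` attached to a Boolean matrix entry. -/
def boolScalar (k : Type) [Field k] (b : Bool) : k := if b then 1 else 0

@[simp] lemma boolScalar_true : boolScalar k true = 1 := rfl

@[simp] lemma boolScalar_false : boolScalar k false = 0 := rfl

/-- Vectors `x i j` and functionals `f i j` on the spaces of `M` on which all arrows act by the
same 0-1 matrices, and such that `v ↦ ∑ j, f i j v • x i j` fixes the vectors `x i j`. -/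
structure Frame (M : QRep k n) (J : Type) [Fintype J] where
  x : ∀ i, J → M.V i
  f : ∀ i, J → Dual k (M.V i)
  E : ℕ → J → J → Bool
  A : J → J → Bool
  B : J → J → Bool
  C : J → J → Bool
  D : ℕ → J → J → Bool
  gram : ∀ i j j', f i j (x i j') = boolScalar k (E i j j')
  fix : ∀ i j', ∑ j, f i j (x i j') • x i j = x i j'
  αx : ∀ j, M.α (x 2 j) = ∑ j', boolScalar k (A j' j) • x 1 j'
  αf : ∀ j' v, f 1 j' (M.α v) = ∑ j, boolScalar k (A j' j) * f 2 j v
  βx : ∀ j, M.β (x 3 j) = ∑ j', boolScalar k (B j' j) • x 2 j'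
  βf : ∀ j' v, f 2 j' (M.β v) = ∑ j, boolScalar k (B j' j) * f 3 j v
  γx : ∀ j, M.γ (x 3 j) = ∑ j', boolScalar k (C j' j) • x 1 j'
  γf : ∀ j' v, f 1 j' (M.γ v) = ∑ j, boolScalar k (C j' j) * f 3 j v
  δx : ∀ i (h1 : 4 ≤ i) (h2 : i ≤ n) j,
    M.δ i h1 h2 (x i j) = ∑ j', boolScalar k (D i j' j) • x (i-1) j'
  δf : ∀ i (h1 : 4 ≤ i) (h2 : i ≤ n) j' v,
    f (i-1) j' (M.δ i h1 h2 v) = ∑ j, boolScalar k (D i j' j) * f i j v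

namespace Frame

variable {M N : QRep k n} {J : Type} [Fintype J]

/-- The map sending the coordinates of a vector with respect to one family of functionals to the
vector with the same coordinates with respect to a second family of vectors. -/
def transfer {U W : Type} [AddCommGroup U] [Module k U] [AddCommGroup W] [Module k W]
    (f : J → Dual k U) (x : J → W) : U →ₗ[k] W :=
  ∑ j, (f j).smulRight (x j)

lemma transfer_apply {U W : Type} [AddCommGroup U] [Module k U] [AddCommGroup W] [Module k W]
    (f : J → Dual k U) (x : J → W) (u : U) : transfer f x u = ∑ j, f j u • x j := by
  simp [transfer]

/-- Transfer maps commute with arrows which have the same matrix on both sides. -/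
lemma transfer_comm {U U' W W' : Type} [AddCommGroup U] [Module k U] [AddCommGroup W] [Module k W]
    [AddCommGroup U'] [Module k U'] [AddCommGroup W'] [Module k W']
    (f : J → Dual k U) (f' : J → Dual k U') (x : J → W) (x' : J → W')
    (a : U →ₗ[k] U') (b : W →ₗ[k] W') (A : J → J → k)
    (hf : ∀ j' v, f' j' (a v) = ∑ j, A j' j * f j v)
    (hx : ∀ j, b (x j) = ∑ j', A j' j • x' j') (u : U) :
    transfer f' x' (a u) = b (transfer f x u) := by
  simp only [transfer_apply, hf, map_sum, map_smul, hx, Finset.smul_sum, Finset.sum_smul, smul_smul]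
  rw [Finset.sum_comm]
  simp only [mul_comm]

/-- The endomorphism `v ↦ ∑ j, f i j v • x i j` of a framed representation. -/
def proj (F : Frame M J) : QEnd M where
  f i := transfer (F.f i) (F.x i)
  commα := LinearMap.ext <| transfer_comm _ _ _ _ _ _ _ F.αf F.αx
  commβ := LinearMap.ext <| transfer_comm _ _ _ _ _ _ _ F.βf F.βx
  commγ := LinearMap.ext <| transfer_comm _ _ _ _ _ _ _ F.γf F.γx
  commδ i h1 h2 := LinearMap.ext <| transfer_comm _ _ _ _ _ _ _ (F.δf i h1 h2) (F.δx i h1 h2)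

/-- The frame spans every space of the representation. -/
def Spans (F : Frame M J) : Prop := ∀ i v, transfer (F.f i) (F.x i) v = v

lemma transfer_x (F : Frame M J) (i : ℕ) (j : J) :
    transfer (F.f i) (F.x i) (F.x i j) = F.x i j := by
  rw [transfer_apply, F.fix]

lemma spans_of_division (F : Frame M J) (hM : QEndDivision M) (hF : ∃ i j, F.x i j ≠ 0) :
    F.Spans := by
  obtain ⟨i₀, j₀, h₀⟩ := hF
  obtain ⟨ψ, hψ⟩ := hM F.proj ⟨i₀, fun h => h₀ <| by
    rw [← F.transfer_x i₀ j₀]; exact LinearMap.congr_fun h _⟩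
  intro i v
  have hp : ∀ w, transfer (F.f i) (F.x i) (transfer (F.f i) (F.x i) w)
      = transfer (F.f i) (F.x i) w := by
    intro w
    rw [transfer_apply (F.f i) (F.x i) w]
    simp only [map_sum, map_smul, F.transfer_x]
  have hl : ∀ w, ψ.f i (transfer (F.f i) (F.x i) w) = w := LinearMap.congr_fun (hψ i).1
  rw [← hl (transfer (F.f i) (F.x i) v), hp, hl]

/-- The finite type of the 0-1 matrices attached to a frame. -/
abbrev Code (n : ℕ) (J : Type) : Type :=
  (Fin (n + 1) → J → J → Bool) × (J → J → Bool) × (J → J → Bool) × (J → J → Bool) ×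
    (Fin (n + 1) → J → J → Bool)

/-- The 0-1 matrices attached to a frame. -/
def code (F : Frame M J) : Code n J := (fun i => F.E i, F.A, F.B, F.C, fun i => F.D i)

lemma transfer_transfer (F : Frame M J) (G : Frame N J) (hF : F.Spans) (i : ℕ)
    (h : i ≤ n → F.E i = G.E i) (v : M.V i) :
    transfer (G.f i) (F.x i) (transfer (F.f i) (G.x i) v) = v := by
  by_cases hi : i ≤ n
  · rw [transfer_apply (F.f i)]
    simp only [map_sum, map_smul]
    have hx : ∀ j, transfer (G.f i) (F.x i) (G.x i j) = F.x i j := fun j => by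
      rw [transfer_apply, ← F.fix i j]
      simp only [G.gram, F.gram, h hi]
    simp only [hx]
    rw [← transfer_apply, hF]
  · have := M.supp i (Or.inr (by omega))
    exact Subsingleton.elim _ _

lemma iso_of_code_eq (F : Frame M J) (G : Frame N J) (hF : F.Spans) (hG : G.Spans)
    (h : F.code = G.code) : QIso M N := by
  simp only [code, Prod.mk.injEq] at h
  obtain ⟨hE, hA, hB, hC, hD⟩ := h
  have hE' : ∀ i ≤ n, F.E i = G.E i := fun i hi => congrFun hE ⟨i, by omega⟩
  have hD' : ∀ i ≤ n, F.D i = G.D i := fun i hi => congrFun hD ⟨i, by omega⟩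
  refine ⟨fun i => LinearEquiv.ofLinearMap (transfer (F.f i) (G.x i)) (transfer (G.f i) (F.x i))
    (LinearMap.ext fun v => G.transfer_transfer F hG i (fun hi => (hE' i hi).symm) v)
    (LinearMap.ext fun v => F.transfer_transfer G hF i (hE' i) v), ?_, ?_, ?_, ?_⟩
  · exact transfer_comm _ _ _ _ _ _ _ F.αf (hA ▸ G.αx)
  · exact transfer_comm _ _ _ _ _ _ _ F.βf (hB ▸ G.βx)
  · exact transfer_comm _ _ _ _ _ _ _ F.γf (hC ▸ G.γx)
  · intro i h1 h2
    exact transfer_comm _ _ _ _ _ _ _ (F.δf i h1 h2) (hD' i h2 ▸ G.δx i h1 h2)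

end Frame

/-- The representation has a spanning frame indexed by `J`. -/
def HasFrame (M : QRep k n) (J : Type) [Fintype J] : Prop := ∃ F : Frame M J, F.Spans

/-- Up to isomorphism there are finitely many representations with a spanning frame. -/
lemma exists_list_of_hasFrame (k : Type) [Field k] (n : ℕ) (J : Type) [Fintype J] :
    ∃ L : List (QRep k n), ∀ M : QRep k n, HasFrame M J → ∃ N ∈ L, QIso M N := by
  classical
  let P : Frame.Code n J → QRep k n → Prop := fun c M => ∃ F : Frame M J, F.Spans ∧ F.code = c
  let S : Set (QRep k n) := Set.range fun c : {c // ∃ M, P c M} => c.2.choose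
  have hS : S.Finite := Set.finite_range _
  refine ⟨hS.toFinset.toList, fun M ⟨F, hF⟩ => ?_⟩
  have hc : ∃ M, P F.code M := ⟨M, F, hF, rfl⟩
  obtain ⟨G, hG, hGF⟩ := hc.choose_spec
  exact ⟨hc.choose, Finset.mem_toList.2 (hS.mem_toFinset.2 ⟨⟨F.code, hc⟩, rfl⟩),
    F.iso_of_code_eq G hF hG hGF.symm⟩

/-! ### Construction of frames -/

section local_data

variable {J : Type} [Fintype J] {U W : Type} [AddCommGroup U] [Module k U] [AddCommGroup W]
  [Module k W]

/-- Vectors and functionals with 0-1 pairings such that the attached map fixes the vectors. -/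
def IsLocalFrame (f : J → Dual k U) (x : J → U) : Prop :=
  (∀ j j', f j (x j') = 0 ∨ f j (x j') = 1) ∧ ∀ l, ∑ j, f j (x l) • x j = x l

/-- An arrow acts on the vectors and functionals at its ends by a common 0-1 matrix. -/
def MatrixCompat (a : U →ₗ[k] W) (u : J → U) (f : J → Dual k U) (w : J → W) (g : J → Dual k W) :
    Prop :=
  ∃ A : J → J → Bool, (∀ j, a (u j) = ∑ j', boolScalar k (A j' j) • w j') ∧
    ∀ j' v, g j' (a v) = ∑ j, boolScalar k (A j' j) * f j v

lemma MatrixCompat.of_zero {a : U →ₗ[k] W} {u : J → U} {f : J → Dual k U} {w : J → W}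
    {g : J → Dual k W} (ha : a = 0) : MatrixCompat a u f w g :=
  ⟨fun _ _ => false, by simp [ha], by simp [ha]⟩

/-- A vector and a functional at each end of an arrow, compatible with the arrow acting as
the scalar `1` or `0`. -/
def ArrowCompat (a : U →ₗ[k] W) (u : U) (f : Dual k U) (w : W) (g : Dual k W) : Prop :=
  (a u = w ∧ g ∘ₗ a = f) ∨ (a u = 0 ∧ g ∘ₗ a = 0)

lemma ArrowCompat.of_zero {a : U →ₗ[k] W} {u : U} {f : Dual k U} {w : W}
    {g : Dual k W} (ha : a = 0) : ArrowCompat a u f w g :=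
  Or.inr (by simp [ha])

lemma ArrowCompat.of_eq_zero {a : U →ₗ[k] W} {f : Dual k U} {w : W} :
    ArrowCompat a 0 f w 0 :=
  Or.inr (by simp)

lemma ArrowCompat.matrixCompat {a : U →ₗ[k] W} {u : U} {f : Dual k U} {w : W} {g : Dual k W}
    (h : ArrowCompat a u f w g) :
    MatrixCompat (J := Unit) a (fun _ => u) (fun _ => f) (fun _ => w) (fun _ => g) := by
  rcases h with ⟨h1, h2⟩ | ⟨h1, h2⟩
  · exact ⟨fun _ _ => true, fun _ => by simpa using h1,
      fun _ v => by simpa using LinearMap.congr_fun h2 v⟩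
  · exact ⟨fun _ _ => false, fun _ => by simpa using h1,
      fun _ v => by simpa using LinearMap.congr_fun h2 v⟩

lemma isLocalFrame_unit {f : Dual k U} {x : U} (h : f x = 1 ∨ x = 0) :
    IsLocalFrame (J := Unit) (fun _ => f) (fun _ => x) := by
  rcases h with h | h <;> simp [IsLocalFrame, h]

end local_data

/-- The arrow `t + 4 → t + 3`. -/
def stepMap (M : QRep k n) (t : ℕ) : M.V (t + 4) →ₗ[k] M.V (t + 3) :=
  if h : t + 4 ≤ n then M.δ (t + 4) (by omega) h else 0

lemma stepMap_eq (M : QRep k n) (t : ℕ) (h1 : 4 ≤ t + 4) (h2 : t + 4 ≤ n) :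
    stepMap M t = M.δ (t + 4) h1 h2 := dif_pos h2

/-- A family over all vertices from its values at `0`, `1`, `2` and at the vertices `t + 3`. -/
def assemble {X : ℕ → Type} (x₀ : X 0) (x₁ : X 1) (x₂ : X 2) (y : ∀ t, X (t + 3)) : ∀ i, X i
  | 0 => x₀
  | 1 => x₁
  | 2 => x₂
  | t + 3 => y t

/-- A brick has a spanning frame as soon as it has compatible local frames, not all zero. -/
lemma hasFrame_of_local {M : QRep k n} (hM : QEndDivision M) {J : Type} [Fintype J]
    (x₁ : J → M.V 1) (x₂ : J → M.V 2) (y : ∀ t, J → M.V (t + 3))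
    (f₁ : J → Dual k (M.V 1)) (f₂ : J → Dual k (M.V 2)) (g : ∀ t, J → Dual k (M.V (t + 3)))
    (h₁ : IsLocalFrame f₁ x₁) (h₂ : IsLocalFrame f₂ x₂) (hy : ∀ t, IsLocalFrame (g t) (y t))
    (h0 : (∃ j, x₁ j ≠ 0) ∨ (∃ j, x₂ j ≠ 0) ∨ ∃ t j, y t j ≠ 0)
    (hα : MatrixCompat M.α x₂ f₂ x₁ f₁) (hβ : MatrixCompat M.β (y 0) (g 0) x₂ f₂)
    (hγ : MatrixCompat M.γ (y 0) (g 0) x₁ f₁)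
    (hδ : ∀ t, MatrixCompat (stepMap M t) (y (t + 1)) (g (t + 1)) (y t) (g t)) :
    HasFrame M J := by
  classical
  obtain ⟨A, hA⟩ := hα
  obtain ⟨B, hB⟩ := hβ
  obtain ⟨C, hC⟩ := hγ
  choose D hD using hδ
  let x : ∀ i, J → M.V i := assemble (X := fun i => J → M.V i) 0 x₁ x₂ y
  let f : ∀ i, J → Dual k (M.V i) := assemble (X := fun i => J → Dual k (M.V i)) 0 f₁ f₂ g
  have hx : ∀ i, IsLocalFrame (f i) (x i)
    | 0 => ⟨fun _ _ => Or.inl rfl, fun _ => by simp [x, assemble]⟩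
    | 1 => h₁
    | 2 => h₂
    | t + 3 => hy t
  let F : Frame M J :=
    { x := x
      f := f
      E := fun i j j' => decide (f i j (x i j') = 1)
      A := A
      B := B
      C := C
      D := fun i => D (i - 4)
      gram := fun i j j' => by rcases (hx i).1 j j' with h | h <;> simp [h]
      fix := fun i => (hx i).2
      αx := hA.1
      αf := hA.2
      βx := hB.1
      βf := hB.2
      γx := hC.1
      γf := hC.2
      δx := fun i h1 h2 => by
        obtain ⟨t, rfl⟩ := Nat.exists_eq_add_of_le' h1
        have := (hD t).1
        rwa [stepMap_eq M t h1 h2] at this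
      δf := fun i h1 h2 => by
        obtain ⟨t, rfl⟩ := Nat.exists_eq_add_of_le' h1
        have := (hD t).2
        rwa [stepMap_eq M t h1 h2] at this }
  refine ⟨F, F.spans_of_division hM ?_⟩
  rcases h0 with h | h | ⟨t, h⟩
  · exact ⟨1, h⟩
  · exact ⟨2, h⟩
  · exact ⟨t + 3, h⟩

lemma hasFrame_unit {M : QRep k n} (hM : QEndDivision M)
    (x₁ : M.V 1) (x₂ : M.V 2) (y : ∀ t, M.V (t + 3))
    (f₁ : Dual k (M.V 1)) (f₂ : Dual k (M.V 2)) (g : ∀ t, Dual k (M.V (t + 3)))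
    (h₁ : f₁ x₁ = 1 ∨ x₁ = 0) (h₂ : f₂ x₂ = 1 ∨ x₂ = 0) (hy : ∀ t, g t (y t) = 1 ∨ y t = 0)
    (h0 : x₁ ≠ 0 ∨ x₂ ≠ 0 ∨ ∃ t, y t ≠ 0)
    (hα : ArrowCompat M.α x₂ f₂ x₁ f₁) (hβ : ArrowCompat M.β (y 0) (g 0) x₂ f₂)
    (hγ : ArrowCompat M.γ (y 0) (g 0) x₁ f₁)
    (hδ : ∀ t, ArrowCompat (stepMap M t) (y (t + 1)) (g (t + 1)) (y t) (g t)) :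
    HasFrame M Unit :=
  hasFrame_of_local hM (fun _ => x₁) (fun _ => x₂) (fun t _ => y t) (fun _ => f₁) (fun _ => f₂)
    (fun t _ => g t) (isLocalFrame_unit h₁) (isLocalFrame_unit h₂)
    (fun t => isLocalFrame_unit (hy t)) (by simpa using h0) hα.matrixCompat hβ.matrixCompat
    hγ.matrixCompat (fun t => (hδ t).matrixCompat)

/-! ### The linear part of the quiver -/

/-- The composite `j + 3 → i + 3` of the linear part of the quiver; zero when `j < i`. -/
def chainMap (M : QRep k n) (i : ℕ) : ∀ j, M.V (j + 3) →ₗ[k] M.V (i + 3)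
  | 0 => if h : 0 = i then h ▸ LinearMap.id else 0
  | j + 1 => if h : j + 1 = i then h ▸ LinearMap.id else chainMap M i j ∘ₗ stepMap M j

section chain

variable (M : QRep k n)

lemma chainMap_self (i : ℕ) : chainMap M i i = LinearMap.id := by
  cases i <;> simp [chainMap]

lemma chainMap_succ {i j : ℕ} (h : i ≤ j) :
    chainMap M i (j + 1) = chainMap M i j ∘ₗ stepMap M j := by
  rw [chainMap, dif_neg (by omega)]

lemma chainMap_of_lt {i j : ℕ} (h : j < i) : chainMap M i j = 0 := by
  induction j with
  | zero => rw [chainMap, dif_neg (by omega)]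
  | succ j ih => rw [chainMap, dif_neg (by omega), ih (by omega), LinearMap.zero_comp]

lemma chainMap_comp {i j l : ℕ} (h : i ≤ j) (h' : j ≤ l) :
    chainMap M i j ∘ₗ chainMap M j l = chainMap M i l := by
  induction l, h' using Nat.le_induction with
  | base => rw [chainMap_self, LinearMap.comp_id]
  | succ l hl ih =>
    rw [chainMap_succ M hl, chainMap_succ M (h.trans hl), ← ih, LinearMap.comp_assoc]

lemma chainMap_succ_self (i : ℕ) : chainMap M i (i + 1) = stepMap M i := by
  rw [chainMap_succ M le_rfl, chainMap_self, LinearMap.id_comp]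

lemma stepMap_chainMap {i j : ℕ} (h : i + 1 ≤ j) (z : M.V (j + 3)) :
    stepMap M i (chainMap M (i + 1) j z) = chainMap M i j z := by
  rw [← chainMap_succ_self, ← LinearMap.comp_apply, chainMap_comp M (by omega) h]

lemma chainMap_chainMap {i j l : ℕ} (h : i ≤ j) (h' : j ≤ l) (z : M.V (l + 3)) :
    chainMap M i j (chainMap M j l z) = chainMap M i l z :=
  LinearMap.congr_fun (chainMap_comp M h h') z

lemma antitone_range_comp_chainMap {U : Type} [AddCommGroup U] [Module k U] {i : ℕ}
    (φ : M.V (i + 3) →ₗ[k] U) {s t : ℕ} (hs : i ≤ s) (h : s ≤ t) :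
    LinearMap.range (φ ∘ₗ chainMap M i t) ≤ LinearMap.range (φ ∘ₗ chainMap M i s) := by
  rw [← chainMap_comp M hs h, ← LinearMap.comp_assoc]
  exact LinearMap.range_comp_le_range _ _

lemma range_comp_chainMap_eq_bot {U : Type} [AddCommGroup U] [Module k U] {i : ℕ}
    (φ : M.V (i + 3) →ₗ[k] U) : LinearMap.range (φ ∘ₗ chainMap M i n) = ⊥ := by
  have := M.supp (n + 3) (Or.inr (by omega))
  rw [LinearMap.range_eq_bot]
  exact LinearMap.ext fun v => by rw [Subsingleton.elim v 0, map_zero, map_zero]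

/-- The images of a vector at the vertex `m + 3` and the pullbacks of a functional at the vertex
`i + 3` form a thin frame of the linear part of the quiver. -/
lemma chain_frame {i m : ℕ} (him : i ≤ m) (z : M.V (m + 3)) (f : Dual k (M.V (i + 3)))
    (hz : f (chainMap M i m z) = 1) (hf : f ∘ₗ chainMap M i (m + 1) = 0)
    (hi : ∀ t < i, Subsingleton (M.V (t + 3))) :
    (∀ t, (f ∘ₗ chainMap M i t) (chainMap M t m z) = 1 ∨ chainMap M t m z = 0) ∧
    ∀ t, ArrowCompat (stepMap M t) (chainMap M (t + 1) m z) (f ∘ₗ chainMap M i (t + 1))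
      (chainMap M t m z) (f ∘ₗ chainMap M i t) := by
  have hf' : ∀ t, m < t → f ∘ₗ chainMap M i t = 0 := fun t ht => by
    rw [← chainMap_comp M (show i ≤ m + 1 by omega) ht, ← LinearMap.comp_assoc, hf,
      LinearMap.zero_comp]
  refine ⟨fun t => ?_, fun t => ?_⟩
  · rcases lt_or_ge t i with h | h
    · have := hi t h
      exact Or.inr (Subsingleton.elim _ _)
    rcases lt_or_ge m t with h' | h'
    · exact Or.inr (by rw [chainMap_of_lt M h', LinearMap.zero_apply])
    · exact Or.inl (by rw [LinearMap.comp_apply, chainMap_chainMap M h h', hz])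
  · rcases lt_or_ge t i with h | h
    · have := hi t h
      refine Or.inr ⟨Subsingleton.elim _ _, ?_⟩
      rw [chainMap_of_lt M h, LinearMap.comp_zero, LinearMap.zero_comp]
    rcases lt_or_ge m (t + 1) with h' | h'
    · refine Or.inr ⟨by rw [chainMap_of_lt M h', LinearMap.zero_apply, map_zero], ?_⟩
      rw [LinearMap.comp_assoc, ← chainMap_succ M h, hf' _ h']
    · exact Or.inl ⟨stepMap_chainMap M h' z, by rw [LinearMap.comp_assoc, ← chainMap_succ M h]⟩

end chain

/-! ### Linear algebra of filtrations -/

section filtration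

variable {U : Type} [AddCommGroup U] [Module k U]

lemma exists_last {P : ℕ → Prop} {i N : ℕ} (hi : P i) (hN : ∀ t, N ≤ t → ¬ P t) :
    ∃ m, i ≤ m ∧ P m ∧ ¬ P (m + 1) := by
  by_contra! h
  exact hN (max i N) (le_max_right _ _)
    (Nat.le_induction hi (fun m hm => h m hm) _ (le_max_left _ _))

lemma exists_functional {x : U} {S : Submodule k U} (h : x ∉ S) :
    ∃ f : Dual k U, f x = 1 ∧ ∀ y ∈ S, f y = 0 := by
  obtain ⟨f, hx, hS⟩ := Submodule.exists_le_ker_of_notMem h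
  exact ⟨(f x)⁻¹ • f, by simp [hx], fun y hy => by
    have : f y = 0 := hS hy
    simp [this]⟩

lemma exists_functional_extending {S T : Submodule k U} (h : Disjoint S T) (f : Dual k U) :
    ∃ g : Dual k U, (∀ y ∈ S, g y = 0) ∧ ∀ y ∈ T, g y = f y := by
  obtain ⟨S', hS, hc⟩ := h.exists_isCompl
  refine ⟨f ∘ₗ T.subtype ∘ₗ T.projectionOnto S' hc.symm, fun y hy => ?_, fun y hy => ?_⟩
  · simp [Submodule.projectionOnto_apply_of_mem_right hc.symm (hS hy)]
  · have := Submodule.projectionOnto_apply_left hc.symm ⟨y, hy⟩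
    simp only [LinearMap.comp_apply] at this ⊢
    rw [this]; rfl

lemma exists_functional_comp {W : Type} [AddCommGroup W] [Module k W] (a : U →ₗ[k] W)
    (f : Dual k U) (h : ∀ y ∈ LinearMap.ker a, f y = 0) : ∃ g : Dual k W, g ∘ₗ a = f := by
  have : f ∈ (LinearMap.ker a).dualAnnihilator := by simpa [Submodule.mem_dualAnnihilator] using h
  rw [← LinearMap.range_dualMap_eq_dualAnnihilator_ker] at this
  exact this

/-- Normal forms for a filtration together with two subspaces. -/
lemma filtration_normal_form (F : ℕ → Submodule k U) (hF : Antitone F) (h0 : F 0 = ⊤) {N : ℕ}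
    (hN : F N = ⊥) (K₁ K₂ : Submodule k U) [Nontrivial U] :
    (∃ m, ∃ x ∈ F m, ∃ f : Dual k U, f x = 1 ∧ (∀ y ∈ F (m + 1), f y = 0) ∧
      (x ∈ K₁ ∨ ∀ y ∈ K₁, f y = 0) ∧ (x ∈ K₂ ∨ ∀ y ∈ K₂, f y = 0)) ∨
    ∃ p q, p < q ∧ ∃ e₁ ∈ K₁, ∃ e₂ ∈ K₂, e₁ ∈ F p ∧ e₁ + e₂ ∈ F q ∧
      ∃ f₁ f₂ : Dual k U, (∀ y ∈ K₂, f₁ y = 0) ∧ (∀ y ∈ K₁, f₂ y = 0) ∧ f₁ e₁ = 1 ∧ f₂ e₂ = 1 ∧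
        (∀ y ∈ F (p + 1), f₁ y = f₂ y) ∧ ∀ y ∈ F (q + 1), f₁ y = 0 := by
  have hbot : ∀ t, N ≤ t → F t = ⊥ := fun t ht => le_bot_iff.1 (hN ▸ hF ht)
  have single : ∀ x : U, x ≠ 0 → ∃ m, x ∈ F m ∧ ∃ f : Dual k U, f x = 1 ∧
      ∀ y ∈ F (m + 1), f y = 0 := fun x hx => by
    obtain ⟨m, -, hm, hm'⟩ := exists_last (P := fun t => x ∈ F t) (i := 0) (N := N)
      (by simp [h0]) (fun t ht => by simpa [hbot t ht] using hx)
    exact ⟨m, hm, exists_functional hm'⟩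
  by_cases h₁ : K₁ = ⊥
  · subst h₁
    left
    by_cases h₂ : K₂ = ⊥
    · obtain ⟨x, hx⟩ := exists_ne (0 : U)
      obtain ⟨m, hm, f, hfx, hf⟩ := single x hx
      exact ⟨m, x, hm, f, hfx, hf, by simp, by simp [h₂]⟩
    · obtain ⟨x, hx₂, hx⟩ := K₂.exists_mem_ne_zero_of_ne_bot h₂
      obtain ⟨m, hm, f, hfx, hf⟩ := single x hx
      exact ⟨m, x, hm, f, hfx, hf, by simp, Or.inl hx₂⟩
  by_cases h₁₂ : K₁ ⊓ K₂ = ⊥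
  swap
  · obtain ⟨x, hxK, hx⟩ := Submodule.exists_mem_ne_zero_of_ne_bot h₁₂
    obtain ⟨m, hm, f, hfx, hf⟩ := single x hx
    exact Or.inl ⟨m, x, hm, f, hfx, hf, Or.inl hxK.1, Or.inl hxK.2⟩
  obtain ⟨p, -, hp, hp'⟩ := exists_last (P := fun t => K₁ ⊓ F t ≠ ⊥) (i := 0) (N := N)
    (by simpa [h0] using h₁) (fun t ht => by simp [hbot t ht])
  obtain ⟨e₁, ⟨he₁, hep⟩, he₁0⟩ := Submodule.exists_mem_ne_zero_of_ne_bot hp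
  by_cases hmem : e₁ ∈ K₂ ⊔ F (p + 1)
  swap
  · obtain ⟨f, hfx, hf⟩ := exists_functional hmem
    exact Or.inl ⟨p, e₁, hep, f, hfx, fun y hy => hf y (Submodule.mem_sup_right hy), Or.inl he₁,
      Or.inr fun y hy => hf y (Submodule.mem_sup_left hy)⟩
  right
  have he₁2 : e₁ ∉ K₂ := fun h => he₁0 <| by
    have : e₁ ∈ K₁ ⊓ K₂ := ⟨he₁, h⟩
    simpa [h₁₂] using this
  obtain ⟨q, hpq, hq, hq'⟩ := exists_last (P := fun t => e₁ ∈ K₂ ⊔ F t) (N := N) hmem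
    (fun t ht => by simpa [hbot t ht] using he₁2)
  obtain ⟨u, hu, w, hw, huw⟩ := Submodule.mem_sup.1 hq
  obtain ⟨f₁, hf₁, hf₁'⟩ := exists_functional hq'
  obtain ⟨f₂, hf₂, hf₂'⟩ := exists_functional_extending (disjoint_iff.2 (not_not.1 hp')) f₁
  have hw' : e₁ + -u = w := by rw [← huw]; abel
  have hfK : ∀ y ∈ K₂, f₁ y = 0 := fun y hy => hf₁' y (Submodule.mem_sup_left hy)
  refine ⟨p, q, hpq, e₁, he₁, -u, K₂.neg_mem hu, hep, hw' ▸ hw, f₁, f₂, hfK, hf₂, hf₁, ?_,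
    fun y hy => (hf₂' y hy).symm, fun y hy => hf₁' y (Submodule.mem_sup_right hy)⟩
  have h := hf₂' w (hF hpq hw)
  rw [← hw', map_add, map_add, hf₂ e₁ he₁, hf₁, hfK _ (K₂.neg_mem hu)] at h
  simpa using h

end filtration

/-! ### Bricks -/

/-- In a brick one of the arrows `α`, `β` vanishes. -/
lemma α_eq_zero_or_β_eq_zero (M : QRep k n) (hM : QEndDivision M) : M.α = 0 ∨ M.β = 0 := by
  by_contra! h
  obtain ⟨hα, hβ⟩ := h
  obtain ⟨u, hu⟩ : ∃ u, M.α u ≠ 0 := by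
    by_contra! h
    exact hα (LinearMap.ext h)
  obtain ⟨w, hw⟩ : ∃ w, M.β w ≠ 0 := by
    by_contra! h
    exact hβ (LinearMap.ext h)
  have hrel : ∀ v, M.α (M.β v) = 0 := LinearMap.congr_fun M.rel
  have hu' : u ∉ LinearMap.range M.β := by
    rintro ⟨v, rfl⟩
    exact hu (hrel v)
  obtain ⟨f, hf, hf'⟩ := exists_functional hu'
  let φ : ∀ i, M.V i →ₗ[k] M.V i :=
    assemble (X := fun i => M.V i →ₗ[k] M.V i) 0 0 (f.smulRight (M.β w)) 0
  obtain ⟨ψ, hψ⟩ := hM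
    { f := φ
      commα := LinearMap.ext fun v => by
        change 0 = M.α (f v • M.β w)
        rw [map_smul, hrel, smul_zero]
      commβ := LinearMap.ext fun v => by
        change f (M.β v) • M.β w = M.β 0
        rw [hf' _ ⟨v, rfl⟩, zero_smul, map_zero]
      commγ := LinearMap.ext fun v => (map_zero M.γ).symm
      commδ := fun i h1 h2 => by
        obtain ⟨t, rfl⟩ := Nat.exists_eq_add_of_le' h1
        exact LinearMap.ext fun v => (map_zero (M.δ (t + 4) h1 h2)).symm }
    ⟨2, fun h => hw <| by
      have : f u • M.β w = 0 := LinearMap.congr_fun h u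
      rwa [hf, one_smul] at this⟩
  have : w = 0 := (LinearMap.congr_fun (hψ 3).1 w).symm.trans (map_zero (ψ.f 3))
  exact hw (by rw [this, map_zero])

/-- A brick of the linear part of the quiver. -/
lemma hasFrame_of_linear {M : QRep k n} (hM : QEndDivision M) [Subsingleton (M.V 1)]
    [Subsingleton (M.V 2)] (h : ∃ t, Nontrivial (M.V (t + 3))) : HasFrame M Unit := by
  classical
  have hi := Nat.find_spec h
  have hi' : ∀ t < Nat.find h, Subsingleton (M.V (t + 3)) := fun t ht =>
    not_nontrivial_iff_subsingleton.1 (Nat.find_min h ht)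
  generalize Nat.find h = i at hi hi'
  obtain ⟨x, hx⟩ := exists_ne (0 : M.V (i + 3))
  obtain ⟨m, him, hm, hm'⟩ := exists_last (N := max i n) (i := i)
    (P := fun t => x ∈ LinearMap.range (LinearMap.id ∘ₗ chainMap M i t))
    (by simp [chainMap_self]) (fun t ht hxt => hx <| by
      have := (antitone_range_comp_chainMap M LinearMap.id (by omega) (by omega : max i n ≤ t)) hxt
      have hs := M.supp (max i n + 3) (Or.inr (by omega))
      obtain ⟨v, rfl⟩ := this
      rw [Subsingleton.elim v 0, map_zero])
  obtain ⟨f, hfx, hf⟩ := exists_functional hm'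
  obtain ⟨z, rfl⟩ := hm
  obtain ⟨h1, h2⟩ := chain_frame M him z f hfx (LinearMap.ext fun v => hf _ ⟨v, rfl⟩) hi'
  exact hasFrame_unit hM 0 0 (fun t => chainMap M t m z) 0 0 (fun t => f ∘ₗ chainMap M i t)
    (Or.inr rfl) (Or.inr rfl) h1 (Or.inr (Or.inr ⟨i, hx⟩)) (.of_eq_zero)
    (.of_zero (Subsingleton.elim _ _)) (.of_zero (Subsingleton.elim _ _)) h2

/-- A brick with a simple direct summand at the vertex `1`. -/
lemma hasFrame_of_simple_one {M : QRep k n} (hM : QEndDivision M) [Nontrivial (M.V 1)]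
    (hα : M.α = 0) (hγ : M.γ = 0) : HasFrame M Unit := by
  obtain ⟨x, hx⟩ := exists_ne (0 : M.V 1)
  obtain ⟨f, hfx, -⟩ := exists_functional (k := k) (S := ⊥) (x := x) (by simpa using hx)
  exact hasFrame_unit hM x 0 (fun _ => 0) f 0 (fun _ => 0) (Or.inl hfx) (Or.inr rfl)
    (fun _ => Or.inr rfl) (Or.inl hx) (.of_zero hα) .of_eq_zero (.of_zero hγ)
    (fun _ => .of_eq_zero)

/-- A brick with a simple direct summand at the vertex `2`. -/
lemma hasFrame_of_simple_two {M : QRep k n} (hM : QEndDivision M) [Nontrivial (M.V 2)]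
    (hα : M.α = 0) (hβ : M.β = 0) : HasFrame M Unit := by
  obtain ⟨x, hx⟩ := exists_ne (0 : M.V 2)
  obtain ⟨f, hfx, -⟩ := exists_functional (k := k) (S := ⊥) (x := x) (by simpa using hx)
  exact hasFrame_unit hM 0 x (fun _ => 0) 0 f (fun _ => 0) (Or.inr rfl) (Or.inl hfx)
    (fun _ => Or.inr rfl) (Or.inr (Or.inl hx)) (.of_zero hα) (.of_zero hβ) .of_eq_zero
    (fun _ => .of_eq_zero)

/-- A brick with `β = 0` and nonzero space at the vertex `1`. -/
lemma hasFrame_of_β_eq_zero {M : QRep k n} (hM : QEndDivision M) [Nontrivial (M.V 1)]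
    (hβ : M.β = 0) : HasFrame M Unit := by
  obtain ⟨x, hx, hxα⟩ : ∃ x : M.V 1, x ≠ 0 ∧ (M.α = 0 ∨ ∃ u, M.α u = x) := by
    by_cases hα : M.α = 0
    · obtain ⟨x, hx⟩ := exists_ne (0 : M.V 1)
      exact ⟨x, hx, Or.inl hα⟩
    · obtain ⟨u, hu⟩ : ∃ u, M.α u ≠ 0 := by
        by_contra! h
        exact hα (LinearMap.ext h)
      exact ⟨M.α u, hu, Or.inr ⟨u, rfl⟩⟩
  obtain ⟨f, y, g, hfx, hy, hγ, hδ⟩ : ∃ (f : Dual k (M.V 1)) (y : ∀ t, M.V (t + 3))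
      (g : ∀ t, Dual k (M.V (t + 3))), f x = 1 ∧ (∀ t, g t (y t) = 1 ∨ y t = 0) ∧
      ArrowCompat M.γ (y 0) (g 0) x f ∧
      ∀ t, ArrowCompat (stepMap M t) (y (t + 1)) (g (t + 1)) (y t) (g t) := by
    by_cases hxγ : x ∈ LinearMap.range M.γ
    · obtain ⟨m, -, hm, hm'⟩ := exists_last (N := n) (i := 0)
        (P := fun t => x ∈ LinearMap.range (M.γ ∘ₗ chainMap M 0 t))
        (by simpa [chainMap_self] using hxγ) (fun t ht hxt => hx <| by
          have := antitone_range_comp_chainMap M M.γ (Nat.zero_le _) ht hxt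
          rwa [range_comp_chainMap_eq_bot, Submodule.mem_bot] at this)
      obtain ⟨f, hfx, hf⟩ := exists_functional hm'
      obtain ⟨z, rfl⟩ := hm
      obtain ⟨h1, h2⟩ := chain_frame M (Nat.zero_le m) z (f ∘ₗ M.γ) hfx
        (LinearMap.ext fun v => hf _ ⟨v, rfl⟩) (by simp)
      exact ⟨f, _, _, hfx, h1, Or.inl ⟨rfl, by rw [chainMap_self, LinearMap.comp_id]⟩, h2⟩
    · obtain ⟨f, hfx, hf⟩ := exists_functional hxγ
      exact ⟨f, fun _ => 0, fun _ => 0, hfx, fun _ => Or.inr rfl,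
        Or.inr ⟨map_zero _, LinearMap.ext fun v => hf _ ⟨v, rfl⟩⟩, fun _ => .of_eq_zero⟩
  rcases hxα with hα | ⟨u, rfl⟩
  · exact hasFrame_unit hM x 0 y f 0 g (Or.inl hfx) (Or.inr rfl) hy (Or.inl hx) (.of_zero hα)
      (.of_zero hβ) hγ hδ
  · exact hasFrame_unit hM _ u y f (f ∘ₗ M.α) g (Or.inl hfx) (Or.inl hfx) hy (Or.inl hx)
      (Or.inl ⟨rfl, rfl⟩) (.of_zero hβ) hγ hδ

/-- Extending a one-dimensional frame at the source of an arrow to its target. -/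
lemma exists_arrowCompat {U W : Type} [AddCommGroup U] [Module k U] [AddCommGroup W] [Module k W]
    (a : U →ₗ[k] W) {x : U} {f : Dual k U} (hfx : f x = 1)
    (h : x ∈ LinearMap.ker a ∨ ∀ y ∈ LinearMap.ker a, f y = 0) :
    ∃ (w : W) (g : Dual k W), (g w = 1 ∨ w = 0) ∧ ArrowCompat a x f w g := by
  rcases h with h | h
  · exact ⟨0, 0, Or.inr rfl, Or.inr ⟨h, LinearMap.zero_comp _⟩⟩
  · obtain ⟨g, rfl⟩ := exists_functional_comp a f h
    exact ⟨a x, g, Or.inl hfx, Or.inl ⟨rfl, rfl⟩⟩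

/-- A brick with `α = 0` which is two-dimensional at the vertices `3, …, p + 3` and
one-dimensional at the vertices `1`, `2` and `p + 4, …, q + 3`. -/
lemma hasFrame_two {M : QRep k n} (hM : QEndDivision M) (hα : M.α = 0) {p q : ℕ} (hpq : p < q)
    (z₁ : M.V (p + 3)) (z : M.V (q + 3)) (f₁ f₂ : Dual k (M.V 3))
    (h₁ : Dual k (M.V 1)) (h₂ : Dual k (M.V 2)) (hh₁ : h₁ ∘ₗ M.γ = f₂) (hh₂ : h₂ ∘ₗ M.β = f₁)
    (hγ : M.γ (chainMap M 0 p z₁) = 0) (hβ : M.β (chainMap M 0 q z - chainMap M 0 p z₁) = 0)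
    (hf₁ : f₁ (chainMap M 0 p z₁) = 1) (hf₂ : f₂ (chainMap M 0 q z - chainMap M 0 p z₁) = 1)
    (hp : f₁ ∘ₗ chainMap M 0 (p + 1) = f₂ ∘ₗ chainMap M 0 (p + 1))
    (hq : f₁ ∘ₗ chainMap M 0 (q + 1) = 0) : HasFrame M (Fin 2) := by
  have hf₁' : f₁ (chainMap M 0 q z - chainMap M 0 p z₁) = 0 := by
    rw [← hh₂, LinearMap.comp_apply, hβ, map_zero]
  have hf₂' : f₂ (chainMap M 0 p z₁) = 0 := by
    rw [← hh₁, LinearMap.comp_apply, hγ, map_zero]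
  have hfz : f₁ (chainMap M 0 q z) = 1 := by
    rw [map_sub, hf₁, sub_eq_zero] at hf₁'
    exact hf₁'
  have hp' : ∀ t, p < t → f₁ ∘ₗ chainMap M 0 t = f₂ ∘ₗ chainMap M 0 t := fun t ht => by
    rw [← chainMap_comp M (Nat.zero_le (p + 1)) ht, ← LinearMap.comp_assoc, hp,
      LinearMap.comp_assoc]
  have hq' : ∀ t, q < t → f₁ ∘ₗ chainMap M 0 t = 0 := fun t ht => by
    rw [← chainMap_comp M (Nat.zero_le (q + 1)) ht, ← LinearMap.comp_assoc, hq,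
      LinearMap.zero_comp]
  have hg : ∀ (f : Dual k (M.V 3)) t v, f (chainMap M 0 t (stepMap M t v))
      = f (chainMap M 0 (t + 1) v) := fun f t v => by
    rw [chainMap_succ M (Nat.zero_le t), LinearMap.comp_apply]
  let y : ∀ t, Fin 2 → M.V (t + 3) := fun t =>
    if t ≤ p then ![chainMap M t p z₁, chainMap M t q z - chainMap M t p z₁]
    else ![chainMap M t q z, 0]
  let g : ∀ t, Fin 2 → Dual k (M.V (t + 3)) := fun t =>
    if t ≤ p then ![f₁ ∘ₗ chainMap M 0 t, f₂ ∘ₗ chainMap M 0 t]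
    else ![f₁ ∘ₗ chainMap M 0 t, 0]
  have hy0 : y 0 = ![chainMap M 0 p z₁, chainMap M 0 q z - chainMap M 0 p z₁] :=
    if_pos (Nat.zero_le p)
  have hg0 : g 0 = ![f₁, f₂] := by simp [g, chainMap_self]
  refine hasFrame_of_local hM ![0, M.γ (chainMap M 0 q z - chainMap M 0 p z₁)]
    ![M.β (chainMap M 0 p z₁), 0] y ![0, h₁] ![h₂, 0] g ?_ ?_ (fun t => ?_) ?_ (.of_zero hα)
    ?_ ?_ (fun t => ?_)
  · have : h₁ (M.γ (chainMap M 0 q z - chainMap M 0 p z₁)) = 1 := by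
      rw [← hf₂, ← hh₁, LinearMap.comp_apply]
    generalize chainMap M 0 q z - chainMap M 0 p z₁ = e at this
    simp [IsLocalFrame, Fin.forall_fin_two, Fin.sum_univ_two, this]
  · have : h₂ (M.β (chainMap M 0 p z₁)) = 1 := by rw [← hf₁, ← hh₂, LinearMap.comp_apply]
    simp [IsLocalFrame, Fin.forall_fin_two, Fin.sum_univ_two, this]
  · by_cases ht : t ≤ p
    · have e₁ := chainMap_chainMap M (Nat.zero_le t) ht z₁
      have e₂ : chainMap M 0 t (chainMap M t q z - chainMap M t p z₁)
          = chainMap M 0 q z - chainMap M 0 p z₁ := by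
        rw [map_sub, e₁, chainMap_chainMap M (Nat.zero_le t) (by omega)]
      simp only [y, g, if_pos ht]
      generalize chainMap M t q z - chainMap M t p z₁ = w at e₂
      simp [IsLocalFrame, Fin.forall_fin_two, Fin.sum_univ_two, -map_sub, e₁, e₂, hf₁, hf₂, hf₁',
        hf₂']
    · simp only [y, g, if_neg ht]
      by_cases htq : t ≤ q
      · have e := chainMap_chainMap M (Nat.zero_le t) htq z
        simp [IsLocalFrame, Fin.forall_fin_two, Fin.sum_univ_two, e, hfz]
      · simp [IsLocalFrame, Fin.forall_fin_two, Fin.sum_univ_two,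
          chainMap_of_lt M (not_le.1 htq)]
  · refine Or.inr (Or.inr ⟨0, 0, fun h => ?_⟩)
    rw [hy0, Matrix.cons_val_zero] at h
    rw [h, map_zero] at hf₁
    exact zero_ne_one hf₁
  · refine ⟨![![true, false], ![false, false]], ?_, ?_⟩
    · rw [hy0]
      simp [Fin.forall_fin_two, Fin.sum_univ_two, -map_sub, hβ]
    · rw [hg0, ← hh₂]
      simp [Fin.forall_fin_two, Fin.sum_univ_two]
  · refine ⟨![![false, false], ![false, true]], ?_, ?_⟩
    · rw [hy0]
      simp [Fin.forall_fin_two, Fin.sum_univ_two, -map_sub, hγ]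
    · rw [hg0, ← hh₁]
      simp [Fin.forall_fin_two, Fin.sum_univ_two]
  · rcases lt_trichotomy t p with ht | rfl | ht
    · refine ⟨![![true, false], ![false, true]], ?_, ?_⟩
      · simp [y, Fin.forall_fin_two, Fin.sum_univ_two, ht.le, Nat.succ_le_of_lt ht,
          stepMap_chainMap M (Nat.succ_le_of_lt ht), stepMap_chainMap M (show t + 1 ≤ q by omega)]
      · simp [g, Fin.forall_fin_two, Fin.sum_univ_two, ht.le, Nat.succ_le_of_lt ht, hg]
    · refine ⟨![![true, false], ![true, false]], ?_, ?_⟩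
      · simp [y, Fin.forall_fin_two, Fin.sum_univ_two, stepMap_chainMap M hpq]
      · have := fun v => (LinearMap.congr_fun hp v).symm
        simp only [LinearMap.comp_apply] at this
        simp [g, Fin.forall_fin_two, Fin.sum_univ_two, hg, this]
    · have h1 : ¬ t ≤ p := by omega
      have h2 : ¬ t + 1 ≤ p := by omega
      by_cases htq : t + 1 ≤ q
      · refine ⟨![![true, false], ![false, false]], ?_, ?_⟩
        · simp [y, Fin.forall_fin_two, Fin.sum_univ_two, h1, h2, stepMap_chainMap M htq]
        · simp [g, Fin.forall_fin_two, Fin.sum_univ_two, h1, h2, hg]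
      · refine ⟨fun _ _ => false, ?_, ?_⟩
        · simp [y, Fin.forall_fin_two, h2, chainMap_of_lt M (not_le.1 htq)]
        · have := fun v => LinearMap.congr_fun (hq' (t + 1) (not_le.1 htq)) v
          simp only [LinearMap.comp_apply, LinearMap.zero_apply] at this
          simp [g, Fin.forall_fin_two, h1, hg, this]

/-- A brick with `α = 0` and nonzero space at the vertex `3`. -/
lemma hasFrame_of_α_eq_zero {M : QRep k n} (hM : QEndDivision M) [Nontrivial (M.V 3)]
    (hα : M.α = 0) : HasFrame M Unit ∨ HasFrame M (Fin 2) := by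
  have hF : Antitone fun t => LinearMap.range (chainMap M 0 t) := fun s t h =>
    antitone_range_comp_chainMap M LinearMap.id (Nat.zero_le s) h
  rcases filtration_normal_form (fun t => LinearMap.range (chainMap M 0 t)) hF
    (by rw [chainMap_self, LinearMap.range_id])
    (range_comp_chainMap_eq_bot M (i := 0) LinearMap.id) (LinearMap.ker M.γ) (LinearMap.ker M.β)
    with ⟨m, _, ⟨z, rfl⟩, f, hfx, hf, hγ, hβ⟩ |
      ⟨p, q, hpq, _, hγ, e₂, hβ, ⟨z₁, rfl⟩, ⟨z, hz⟩, f₁, f₂, hf₁β, hf₂γ, hf₁, hf₂, hp, hq⟩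
  · left
    obtain ⟨h1, h2⟩ := chain_frame M (Nat.zero_le m) z f hfx
      (LinearMap.ext fun v => hf _ ⟨v, rfl⟩) (by simp)
    obtain ⟨x₁, g₁, hx₁, hγ'⟩ := exists_arrowCompat M.γ hfx hγ
    obtain ⟨x₂, g₂, hx₂, hβ'⟩ := exists_arrowCompat M.β hfx hβ
    have hf0 : f = f ∘ₗ chainMap M 0 0 := by rw [chainMap_self, LinearMap.comp_id]
    refine hasFrame_unit hM x₁ x₂ _ g₁ g₂ _ hx₁ hx₂ h1 (Or.inr (Or.inr ⟨0, fun h => ?_⟩))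
      (.of_zero hα) (hf0 ▸ hβ') (hf0 ▸ hγ') h2
    rw [h, map_zero] at hfx
    exact zero_ne_one hfx
  · right
    obtain rfl : e₂ = chainMap M 0 q z - chainMap M 0 p z₁ := by rw [hz]; abel
    obtain ⟨h₁, hh₁⟩ := exists_functional_comp M.γ f₂ hf₂γ
    obtain ⟨h₂, hh₂⟩ := exists_functional_comp M.β f₁ hf₁β
    exact hasFrame_two hM hα hpq z₁ z f₁ f₂ h₁ h₂ hh₁ hh₂ hγ hβ hf₁ hf₂
      (LinearMap.ext fun v => hp _ ⟨v, rfl⟩) (LinearMap.ext fun v => hq _ ⟨v, rfl⟩)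

/-- The zero representation has a spanning frame. -/
lemma hasFrame_of_subsingleton {M : QRep k n} (h : ∀ i, Subsingleton (M.V i)) :
    HasFrame M Unit := by
  refine ⟨⟨fun _ _ => 0, fun _ _ => 0, fun _ _ _ => false, fun _ _ => false, fun _ _ => false,
    fun _ _ => false, fun _ _ _ => false, ?_, ?_, ?_, ?_, ?_, ?_, ?_, ?_, ?_, ?_⟩,
    fun i _ => (h i).elim _ _⟩ <;> simp

/-- Every brick has a spanning frame with at most two vectors at each vertex. -/
lemma hasFrame_of_division {M : QRep k n} (hM : QEndDivision M) :
    HasFrame M Unit ∨ HasFrame M (Fin 2) := by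
  have hlin : Subsingleton (M.V 1) → Subsingleton (M.V 2) → HasFrame M Unit := fun h1 h2 => by
    by_cases h : ∃ t, Nontrivial (M.V (t + 3))
    · exact hasFrame_of_linear hM h
    · simp only [not_exists, not_nontrivial_iff_subsingleton] at h
      refine hasFrame_of_subsingleton fun i => ?_
      match i with
      | 0 => exact M.supp 0 (Or.inl rfl)
      | 1 => exact h1
      | 2 => exact h2
      | t + 3 => exact h t
  rcases α_eq_zero_or_β_eq_zero M hM with hα | hβ
  · rcases subsingleton_or_nontrivial (M.V 3) with h3 | h3
    · left
      rcases subsingleton_or_nontrivial (M.V 1) with h1 | h1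
      · rcases subsingleton_or_nontrivial (M.V 2) with h2 | h2
        · exact hlin h1 h2
        · exact hasFrame_of_simple_two hM hα (Subsingleton.elim _ _)
      · exact hasFrame_of_simple_one hM hα (Subsingleton.elim _ _)
    · exact hasFrame_of_α_eq_zero hM hα
  · left
    rcases subsingleton_or_nontrivial (M.V 1) with h1 | h1
    · rcases subsingleton_or_nontrivial (M.V 2) with h2 | h2
      · exact hlin h1 h2
      · exact hasFrame_of_simple_two hM (Subsingleton.elim _ _) hβ
    · exact hasFrame_of_β_eq_zero hM hβ

/-- every representation M of (Q, αβ = 0) whose endomorphism ring is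
a division ring satisfies M_α = 0 or M_β = 0 (so M is a representation of the
D_n-type quiver obtained by deleting α or of the A_n-type quiver obtained by
deleting β), and there are only finitely many isomorphism classes of such M. -/
theorem stmt6 (k : Type) [Field k] (n : ℕ) (hn : 3 ≤ n) :
    (∀ M : QRep k n, QEndDivision M → M.α = 0 ∨ M.β = 0) ∧
    ∃ L : List (QRep k n), ∀ M : QRep k n, QEndDivision M → ∃ N ∈ L, QIso M N := by
  obtain ⟨L₁, hL₁⟩ := exists_list_of_hasFrame k n Unit
  obtain ⟨L₂, hL₂⟩ := exists_list_of_hasFrame k n (Fin 2)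
  refine ⟨α_eq_zero_or_β_eq_zero, L₁ ++ L₂, fun M hM => ?_⟩
  rcases hasFrame_of_division hM with h | h
  · obtain ⟨N, hN, hMN⟩ := hL₁ M h
    exact ⟨N, List.mem_append_left _ hN, hMN⟩
  · obtain ⟨N, hN, hMN⟩ := hL₂ M h
    exact ⟨N, List.mem_append_right _ hN, hMN⟩
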